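/- Borodin's generating function for cylindric partitions: let δ=(δ_i)_{1≤i≤h} be a profile and define the multiset W_3(δ) = {h} ∪ {j−i : i<j, δ_i>δ_j} ∪ {h+i−j : i<j, δ_i<δ_j}. Then Σ_{ω ∈ CP_δ} z^{|ω|} = ∏_{k≥0} ∏_{t∈W_3(δ)} (1−z^{hk+t})^{−1}, as an identity of formal power series in z, where CP_δ is the set of cylindric partitions with profile δ. -/

import Mathlib

open scoped BigOperators

/-- An integer partition: a weakly decreasing, finitely supported sequence of
nonnegative integers. -/
structure Ptn where
  toFun : ℕ →₀ ℕ
  antitone' : ∀ ⦃i j : ℕ⦄, i ≤ j → toFun j ≤ toFun i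

namespace Ptn
/-- the `i`-th part (0-indexed) -/
def part (lam : Ptn) (i : ℕ) : ℕ := lam.toFun i
/-- the size `|λ|` -/
def size (lam : Ptn) : ℕ := lam.toFun.sum fun _ k => k
end Ptn

/-- `HStrip μ λ` means `μ ≺ λ`, i.e. `λ/μ` is a horizontal strip:
`λ_i ≥ μ_i ≥ λ_{i+1}` for all `i`. -/
def HStrip (mu lam : Ptn) : Prop :=
  ∀ i : ℕ, mu.part i ≤ lam.part i ∧ lam.part (i + 1) ≤ mu.part i
/-- `δ` is a `±1`-profile on the indices `1, …, h` -/
def IsProfile (h : ℕ) (δ : ℕ → ℤ) : Prop := ∀ i, 1 ≤ i → i ≤ h → δ i = 1 ∨ δ i = -1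

/-- A skew doubled shifted plane partition `ω = (λ^0, …, λ^{m-1})` with profile
`(δ_1, …, δ_{m-1})`: if `δ_{i+1} = 1` then `λ^i ≺ λ^{i+1}`, and if
`δ_{i+1} = -1` then `λ^i ≻ λ^{i+1}`. -/
def IsDSPP (m : ℕ) (δ : ℕ → ℤ) (L : Fin m → Ptn) : Prop :=
  ∀ (i : ℕ) (hi : i + 1 < m),
    if δ (i + 1) = 1 then HStrip (L ⟨i, Nat.lt_of_succ_lt hi⟩) (L ⟨i + 1, hi⟩)
    else HStrip (L ⟨i + 1, hi⟩) (L ⟨i, Nat.lt_of_succ_lt hi⟩)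
/-- the coefficientwise (product) topology on formal power series -/
instance : TopologicalSpace (PowerSeries ℚ) :=
  inferInstanceAs (TopologicalSpace ((Unit →₀ ℕ) → ℚ))

/-- the formal variable `z` -/
noncomputable def z : PowerSeries ℚ := PowerSeries.X

/-- the multiset
`W_3(δ) = {h} ∪ {j-i : i<j, δ_i>δ_j} ∪ {h+i-j : i<j, δ_i<δ_j}`
where `1 ≤ i < j ≤ h` -/
def W3 (h : ℕ) (δ : ℕ → ℤ) : Multiset ℕ :=
  h ::ₘ
    ((((Finset.Icc 1 h) ×ˢ (Finset.Icc 1 h)).filter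
        (fun q => q.1 < q.2 ∧ δ q.1 > δ q.2)).val.map (fun q => q.2 - q.1) +
      (((Finset.Icc 1 h) ×ˢ (Finset.Icc 1 h)).filter
        (fun q => q.1 < q.2 ∧ δ q.1 < δ q.2)).val.map (fun q => h + q.1 - q.2))

namespace Ptn

theorem ext_part {a b : Ptn} (h : ∀ i, a.part i = b.part i) : a = b := by
  cases a; cases b
  congr
  exact Finsupp.ext h

theorem part_anti (a : Ptn) {i j : ℕ} (h : i ≤ j) : a.part j ≤ a.part i := a.antitone' h

theorem exists_part_eq_zero (a : Ptn) : ∃ M, a.part M = 0 := by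
  obtain ⟨M, hM⟩ := Infinite.exists_notMem_finset a.toFun.support
  exact ⟨M, Finsupp.notMem_support_iff.mp hM⟩

theorem part_eq_zero_of_le (a : Ptn) {i j : ℕ} (hi : a.part i = 0) (h : i ≤ j) :
    a.part j = 0 := by
  have := a.part_anti h
  omega

/-- The partition whose parts are the values of a weakly decreasing sequence reaching zero. -/
noncomputable def ofFun (f : ℕ → ℕ) (hf : ∀ i, f (i + 1) ≤ f i) (hz : ∃ M, f M = 0) : Ptn where
  toFun := Finsupp.ofSupportFinite f (by
    obtain ⟨M, hM⟩ := hz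
    refine (Set.finite_lt_nat M).subset fun i hi => ?_
    by_contra hlt
    have := antitone_nat_of_succ_le hf (not_lt.mp hlt)
    exact hi (by omega))
  antitone' := antitone_nat_of_succ_le hf

@[simp] theorem part_ofFun (f : ℕ → ℕ) (hf : ∀ i, f (i + 1) ≤ f i) (hz : ∃ M, f M = 0) (i : ℕ) :
    (ofFun f hf hz).part i = f i := rfl

theorem size_eq_sum (a : Ptn) {M : ℕ} (h : a.part M = 0) :
    a.size = ∑ i ∈ Finset.range M, a.part i := by
  refine Finsupp.sum_of_support_subset _ (fun i hi => ?_) _ (by simp)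
  rw [Finset.mem_range]
  by_contra hlt
  exact (Finsupp.mem_support_iff.mp hi) (a.part_eq_zero_of_le h (not_lt.mp hlt))

theorem eq_of_size_eq {a b : Ptn} (h : ∀ i, a.part i ≤ b.part i) (hs : a.size = b.size) :
    a = b := by
  obtain ⟨M, hM⟩ := b.exists_part_eq_zero
  have hM' : a.part M = 0 := by have := h M; omega
  rw [a.size_eq_sum hM', b.size_eq_sum hM] at hs
  have key := (Finset.sum_eq_sum_iff_of_le fun i _ => h i).mp hs
  refine ext_part fun i => ?_
  by_cases hi : i < M
  · exact key i (Finset.mem_range.mpr hi)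
  · rw [a.part_eq_zero_of_le hM' (not_lt.mp hi), b.part_eq_zero_of_le hM (not_lt.mp hi)]

theorem size_le_of_part_le {a b : Ptn} (h : ∀ i, a.part i ≤ b.part i) : a.size ≤ b.size := by
  obtain ⟨M, hM⟩ := b.exists_part_eq_zero
  have hM' : a.part M = 0 := by have := h M; omega
  rw [a.size_eq_sum hM', b.size_eq_sum hM]
  exact Finset.sum_le_sum fun i _ => h i

theorem lt_size_of_part_ne_zero (a : Ptn) {k : ℕ} (h : a.part k ≠ 0) : k < a.size := by
  obtain ⟨M, hM⟩ := a.exists_part_eq_zero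
  have hk : k < M := by
    by_contra hlt
    exact h (a.part_eq_zero_of_le hM (not_lt.mp hlt))
  rw [a.size_eq_sum hM]
  calc k < ∑ i ∈ Finset.range (k + 1), 1 := by simp
    _ ≤ ∑ i ∈ Finset.range (k + 1), a.part i := Finset.sum_le_sum fun i hi => by
        have := a.part_anti (Nat.lt_succ_iff.mp (Finset.mem_range.mp hi))
        omega
    _ ≤ ∑ i ∈ Finset.range M, a.part i :=
        Finset.sum_le_sum_of_subset (Finset.range_mono hk)

theorem exists_common_zero (a b c d : Ptn) :
    ∃ M, a.part M = 0 ∧ b.part M = 0 ∧ c.part M = 0 ∧ d.part M = 0 := by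
  obtain ⟨A, hA⟩ := a.exists_part_eq_zero
  obtain ⟨B, hB⟩ := b.exists_part_eq_zero
  obtain ⟨C, hC⟩ := c.exists_part_eq_zero
  obtain ⟨D, hD⟩ := d.exists_part_eq_zero
  exact ⟨A + B + C + D, a.part_eq_zero_of_le hA (by omega), b.part_eq_zero_of_le hB (by omega),
    c.part_eq_zero_of_le hC (by omega), d.part_eq_zero_of_le hD (by omega)⟩

/-- The sequence with first term `x` followed by the terms of `f`. -/
def prepend (x : ℕ) (f : ℕ → ℕ) : ℕ → ℕ
  | 0 => x
  | i + 1 => f i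

@[simp] theorem prepend_zero (x : ℕ) (f : ℕ → ℕ) : prepend x f 0 = x := rfl

@[simp] theorem prepend_succ (x : ℕ) (f : ℕ → ℕ) (i : ℕ) : prepend x f (i + 1) = f i := rfl

/-- The toggle bijection between common horizontal-strip extensions of two partitions and
common horizontal-strip restrictions together with a natural number. -/
noncomputable def toggle (a b : Ptn) :
    {c : Ptn // HStrip a c ∧ HStrip b c} ≃ ℕ × {c : Ptn // HStrip c a ∧ HStrip c b} where
  toFun c := ⟨c.1.part 0 - max (a.part 0) (b.part 0),
    ofFun (fun i => max (a.part (i + 1)) (b.part (i + 1)) + min (a.part i) (b.part i)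
        - c.1.part (i + 1))
      (fun i => by
        have h1 := c.2.1 (i + 1 + 1)
        have h2 := c.2.2 (i + 1 + 1)
        have h3 := c.2.1 i
        have h4 := c.2.2 i
        omega)
      (by
        obtain ⟨M, ha, hb, -, -⟩ := exists_common_zero a b a b
        refine ⟨M, ?_⟩
        have h1 := a.part_eq_zero_of_le ha (Nat.le_succ M)
        have h2 := b.part_eq_zero_of_le hb (Nat.le_succ M)
        simp only [Nat.succ_eq_add_one] at h1 h2
        omega),
    fun i => by
      have h1 := c.2.1 (i + 1)
      have h2 := c.2.2 (i + 1)
      have h3 := c.2.1 i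
      have h4 := c.2.2 i
      simp only [part_ofFun]
      omega,
    fun i => by
      have h1 := c.2.1 (i + 1)
      have h2 := c.2.2 (i + 1)
      have h3 := c.2.1 i
      have h4 := c.2.2 i
      simp only [part_ofFun]
      omega⟩
  invFun p := ⟨ofFun (prepend (max (a.part 0) (b.part 0) + p.1)
        fun j => max (a.part (j + 1)) (b.part (j + 1)) + min (a.part j) (b.part j) - p.2.1.part j)
      (fun i => by
        have h1 := p.2.2.1 i
        have h2 := p.2.2.2 i
        rcases i with _ | i
        · simp only [prepend_zero, prepend_succ]
          omega
        · have h3 := p.2.2.1 (i + 1)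
          have h4 := p.2.2.2 (i + 1)
          have h5 := p.2.2.1 i
          have h6 := p.2.2.2 i
          simp only [prepend_succ]
          omega)
      (by
        obtain ⟨M, ha, hb, -, -⟩ := exists_common_zero a b a b
        refine ⟨M + 1, ?_⟩
        have h1 := a.part_eq_zero_of_le ha (Nat.le_succ M)
        have h2 := b.part_eq_zero_of_le hb (Nat.le_succ M)
        simp only [Nat.succ_eq_add_one] at h1 h2
        simp only [prepend_succ]
        omega),
    fun i => by
      have h1 := p.2.2.1 i
      have h2 := p.2.2.2 i
      simp only [part_ofFun]
      rcases i with _ | i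
      · simp only [prepend_zero, prepend_succ]
        omega
      · have h5 := p.2.2.1 i
        have h6 := p.2.2.2 i
        simp only [prepend_succ]
        omega,
    fun i => by
      have h1 := p.2.2.1 i
      have h2 := p.2.2.2 i
      simp only [part_ofFun]
      rcases i with _ | i
      · simp only [prepend_zero, prepend_succ]
        omega
      · have h5 := p.2.2.1 i
        have h6 := p.2.2.2 i
        simp only [prepend_succ]
        omega⟩
  left_inv c := by
    refine Subtype.ext (ext_part fun i => ?_)
    rcases i with _ | i
    · have h1 := c.2.1 0
      have h2 := c.2.2 0
      simp only [part_ofFun, prepend_zero]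
      omega
    · have h1 := c.2.1 (i + 1)
      have h2 := c.2.2 (i + 1)
      have h3 := c.2.1 i
      have h4 := c.2.2 i
      simp only [part_ofFun, prepend_succ]
      omega
  right_inv p := by
    refine Prod.ext ?_ (Subtype.ext (ext_part fun i => ?_))
    · simp only [part_ofFun, prepend_zero]
      omega
    · have h1 := p.2.2.1 i
      have h2 := p.2.2.2 i
      simp only [part_ofFun, prepend_succ]
      omega

theorem size_toggle (a b : Ptn) (c : {c : Ptn // HStrip a c ∧ HStrip b c}) :
    c.1.size + (toggle a b c).2.1.size = (toggle a b c).1 + a.size + b.size := by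
  obtain ⟨M, ha, hb, hc, hd⟩ := exists_common_zero a b c.1 (toggle a b c).2.1
  have hc' := c.1.part_eq_zero_of_le hc (Nat.le_succ M)
  have ha' := a.part_eq_zero_of_le ha (Nat.le_succ M)
  have hb' := b.part_eq_zero_of_le hb (Nat.le_succ M)
  rw [size_eq_sum _ hd, size_eq_sum _ hc', size_eq_sum _ ha', size_eq_sum _ hb']
  simp only [Nat.succ_eq_add_one]
  rw [Finset.sum_range_succ' c.1.part]
  have key : ∀ i, c.1.part (i + 1) + (toggle a b c).2.1.part i =
      max (a.part (i + 1)) (b.part (i + 1)) + min (a.part i) (b.part i) := fun i => by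
    have h1 := c.2.1 (i + 1)
    have h2 := c.2.2 (i + 1)
    have h3 := c.2.1 i
    have h4 := c.2.2 i
    simp only [toggle, Equiv.coe_fn_mk, part_ofFun]
    omega
  have key0 : c.1.part 0 = (toggle a b c).1 + max (a.part 0) (b.part 0) := by
    have h1 := c.2.1 0
    have h2 := c.2.2 0
    simp only [toggle, Equiv.coe_fn_mk]
    omega
  have hsum := Finset.sum_congr (rfl : Finset.range M = Finset.range M) fun i _ => key i
  have hmm : ∑ i ∈ Finset.range (M + 1), a.part i + ∑ i ∈ Finset.range (M + 1), b.part i =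
      ∑ i ∈ Finset.range (M + 1), max (a.part i) (b.part i) +
        ∑ i ∈ Finset.range M, min (a.part i) (b.part i) := by
    have h0 : ∑ i ∈ Finset.range M, min (a.part i) (b.part i) =
        ∑ i ∈ Finset.range (M + 1), min (a.part i) (b.part i) := by
      rw [Finset.sum_range_succ, ha, hb]
      simp
    rw [h0, ← Finset.sum_add_distrib, ← Finset.sum_add_distrib]
    exact Finset.sum_congr rfl fun i _ => by omega
  rw [Finset.sum_range_succ' (fun i => max (a.part i) (b.part i))] at hmm
  rw [Finset.sum_add_distrib, Finset.sum_add_distrib] at hsum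
  omega

end Ptn

/-- `f` has, up to degree `N` (exclusive), the numbers of objects of given weight as
coefficients, and all weights are nonnegative. -/
def IsGenFunUpTo (N : ℕ) {α : Type} (w : α → ℤ) (f : PowerSeries ℚ) : Prop :=
  (∀ a, 0 ≤ w a) ∧ ∀ n < N, {a | w a = n}.Finite ∧ f.coeff n = ({a | w a = n}.ncard : ℚ)

namespace IsGenFunUpTo

variable {N : ℕ} {α β : Type} {w : α → ℤ} {v : β → ℤ} {f g : PowerSeries ℚ}

theorem congr (h : IsGenFunUpTo N v f) (e : α ≃ β) (hw : ∀ a, w a = v (e a)) :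
    IsGenFunUpTo N w f := by
  refine ⟨fun a => hw a ▸ h.1 _, fun n hn => ?_⟩
  have hset : {a | w a = n} = e ⁻¹' {b | v b = n} := by
    ext a
    simp [hw]
  obtain ⟨hfin, hcard⟩ := h.2 n hn
  refine ⟨hset ▸ hfin.preimage e.injective.injOn, ?_⟩
  rw [hcard, hset, Set.ncard_preimage_of_injective_subset_range e.injective (by simp)]

/-- The geometric-series factor `1 / (1 - z ^ d)`. -/
theorem _root_.coeff_mul_geom (f : PowerSeries ℚ) {d : ℕ} (hd : 0 < d) (n : ℕ) :
    (f * (1 - z ^ d)⁻¹).coeff n =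
      f.coeff n + if d ≤ n then (f * (1 - z ^ d)⁻¹).coeff (n - d) else 0 := by
  have hinv : (1 - z ^ d) * (1 - z ^ d)⁻¹ = 1 := by
    refine PowerSeries.mul_inv_cancel _ ?_
    simp [z, hd.ne']
  have hg : f * (1 - z ^ d)⁻¹ = f + f * (1 - z ^ d)⁻¹ * z ^ d := by
    linear_combination f * hinv
  conv_lhs => rw [hg]
  rw [map_add, z, PowerSeries.coeff_mul_X_pow']

theorem mul_geom_prod (h : IsGenFunUpTo N v f) {d : ℕ} (hd : 0 < d) :
    IsGenFunUpTo N (fun p : ℕ × β => (d * p.1 + v p.2 : ℤ)) (f * (1 - z ^ d)⁻¹) := by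
  refine ⟨fun p => add_nonneg (by positivity) (h.1 _), fun n => ?_⟩
  induction n using Nat.strong_induction_on with
  | _ n ih =>
  intro hn
  obtain ⟨hfin, hcard⟩ := h.2 n hn
  set S : ℕ → Set (ℕ × β) := fun n => {p | (d * p.1 + v p.2 : ℤ) = n} with hS
  set T : Set (ℕ × β) := Prod.mk 0 '' {b | v b = n} with hT
  have hTfin : T.Finite := hfin.image _
  have hTcard : T.ncard = {b | v b = n}.ncard :=
    Set.ncard_image_of_injective _ (Prod.mk_right_injective 0)
  rw [coeff_mul_geom f hd, hcard, ← hTcard]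
  change (S n).Finite ∧ _ = ((S n).ncard : ℚ)
  split_ifs with hdn
  · obtain ⟨hfin', hcard'⟩ := ih (n - d) (by omega) (by omega)
    set U : Set (ℕ × β) := Prod.map Nat.succ id '' S (n - d) with hU
    have hinj : Function.Injective (Prod.map Nat.succ (id : β → β)) :=
      Nat.succ_injective.prodMap Function.injective_id
    have hun : S n = T ∪ U := by
      ext ⟨m, b⟩
      simp only [hS, hT, hU, Set.mem_union, Set.mem_image, Set.mem_ofPred_eq, Prod.exists,
        Prod.map_apply, id_eq, Prod.mk.injEq]
      constructor
      · intro hmb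
        rcases m with _ | m
        · exact Or.inl ⟨b, by simpa using hmb, rfl, rfl⟩
        · refine Or.inr ⟨m, b, ?_, rfl, rfl⟩
          push_cast [hdn] at hmb ⊢
          linarith
      · rintro (⟨b, hb, rfl, rfl⟩ | ⟨m, b, hb, rfl, rfl⟩)
        · simpa using hb
        · push_cast [hdn] at hb ⊢
          linarith
    have hdis : Disjoint T U := by
      rw [Set.disjoint_left]
      rintro _ ⟨b, -, rfl⟩ ⟨⟨m, c⟩, -, hc⟩
      simp at hc
    rw [hun, Set.ncard_union_eq hdis hTfin (hfin'.image _),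
      Set.ncard_image_of_injective _ hinj, hcard']
    exact ⟨hTfin.union (hfin'.image _), by push_cast; rfl⟩
  · have hun : S n = T := by
      ext ⟨m, b⟩
      simp only [hS, hT, Set.mem_image, Set.mem_ofPred_eq, Prod.mk.injEq]
      constructor
      · intro hmb
        rcases m with _ | m
        · exact ⟨b, by simpa using hmb, rfl, rfl⟩
        · exfalso
          have hb := h.1 b
          push_cast at hmb
          have hdm : (0 : ℤ) ≤ d * m := by positivity
          rw [mul_add, mul_one] at hmb
          omega
      · rintro ⟨b, hb, rfl, rfl⟩
        simpa using hb
    rw [hun]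
    exact ⟨hTfin, by simp⟩

theorem mul_geom (h : IsGenFunUpTo N v f) {d : ℕ} (hd : 0 < d) (e : α ≃ ℕ × β)
    (hw : ∀ a, w a = d * (e a).1 + v (e a).2) : IsGenFunUpTo N w (f * (1 - z ^ d)⁻¹) :=
  (h.mul_geom_prod hd).congr e hw

/-- Two weighted types related by an injection that hits every object of weight below `N` have
the same truncated generating function. -/
theorem of_injective (h : IsGenFunUpTo N w f) (i : α → β) (hi : Function.Injective i)
    (hw : ∀ a, v (i a) = w a) (hv : ∀ b, 0 ≤ v b) (hsurj : ∀ b, v b < N → ∃ a, i a = b) :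
    IsGenFunUpTo N v f := by
  refine ⟨hv, fun n hn => ?_⟩
  obtain ⟨hfin, hcard⟩ := h.2 n hn
  have hset : {b | v b = n} = i '' {a | w a = n} := by
    ext b
    simp only [Set.mem_ofPred_eq, Set.mem_image]
    constructor
    · intro hb
      obtain ⟨a, rfl⟩ := hsurj b (by rw [hb]; exact_mod_cast hn)
      exact ⟨a, by rw [← hw, hb], rfl⟩
    · rintro ⟨a, ha, rfl⟩
      rw [hw, ha]
  rw [hset, Set.ncard_image_of_injective _ hi]
  exact ⟨hfin.image _, hcard⟩

end IsGenFunUpTo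

namespace Ptn

/-- Partitions with at most `k + 1` parts are obtained from those with at most `k` parts by
adding a rectangle with `k + 1` rows. -/
noncomputable def addColumns (k : ℕ) :
    {a : Ptn // a.part (k + 1) = 0} ≃ ℕ × {a : Ptn // a.part k = 0} where
  toFun a := (a.1.part k, ⟨ofFun (fun i => a.1.part i - a.1.part k)
    (fun i => Nat.sub_le_sub_right (a.1.part_anti (Nat.le_succ i)) _) ⟨k, Nat.sub_self _⟩,
    Nat.sub_self _⟩)
  invFun p := ⟨ofFun (fun i => if i ≤ k then p.2.1.part i + p.1 else 0)
    (fun i => by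
      have := p.2.1.part_anti (Nat.le_succ i)
      simp only [Nat.succ_eq_add_one] at this
      split_ifs <;> omega)
    ⟨k + 1, by simp⟩, by simp⟩
  left_inv a := by
    refine Subtype.ext (ext_part fun i => ?_)
    simp only [part_ofFun]
    split_ifs with hi
    · have := a.1.part_anti hi
      omega
    · exact (a.1.part_eq_zero_of_le a.2 (by omega)).symm
  right_inv p := by
    refine Prod.ext ?_ (Subtype.ext (ext_part fun i => ?_))
    · simp [p.2.2]
    · simp only [part_ofFun, le_refl, if_true, p.2.2]
      split_ifs with hi
      · omega
      · have := p.2.1.part_eq_zero_of_le p.2.2 (j := i) (by omega)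
        omega

theorem size_addColumns (k : ℕ) (a : {a : Ptn // a.part (k + 1) = 0}) :
    a.1.size = (k + 1) * (addColumns k a).1 + (addColumns k a).2.1.size := by
  rw [size_eq_sum _ a.2, size_eq_sum _ (addColumns k a).2.2, Finset.sum_range_succ]
  have h : ∀ i ∈ Finset.range k,
      a.1.part i = (addColumns k a).1 + (addColumns k a).2.1.part i := fun i hi => by
    have := a.1.part_anti (Finset.mem_range.mp hi).le
    simp only [addColumns, Equiv.coe_fn_mk, part_ofFun]
    omega
  rw [Finset.sum_congr rfl h, Finset.sum_add_distrib]
  simp only [Finset.sum_const, Finset.card_range, smul_eq_mul]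
  change _ + (addColumns k a).1 = _
  ring

theorem isGenFunUpTo_of_part_eq_zero (N : ℕ) {h : ℕ} (hh : 1 ≤ h) (k : ℕ) :
    IsGenFunUpTo N (fun a : {a : Ptn // a.part k = 0} => (h * a.1.size : ℤ))
      (∏ i ∈ Finset.range k, (1 - z ^ (h * i + h))⁻¹) := by
  induction k with
  | zero =>
    have hz : ∀ a : {a : Ptn // a.part 0 = 0}, a.1.size = 0 := fun a => by
      rw [size_eq_sum _ a.2, Finset.sum_range_zero]
    have hsub : Subsingleton {a : Ptn // a.part 0 = 0} := ⟨fun a b => Subtype.ext <|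
      ext_part fun i => by
        rw [part_eq_zero_of_le _ a.2 (Nat.zero_le i), part_eq_zero_of_le _ b.2 (Nat.zero_le i)]⟩
    let o : {a : Ptn // a.part 0 = 0} := ⟨ofFun (fun _ => 0) (fun _ => le_rfl) ⟨0, rfl⟩, rfl⟩
    refine ⟨fun a => by positivity, fun n _ => ⟨Set.toFinite _, ?_⟩⟩
    rw [Finset.prod_range_zero, PowerSeries.coeff_one]
    simp only [hz, Nat.cast_zero, mul_zero]
    rcases Nat.eq_zero_or_pos n with rfl | hn
    · have : {a : {a : Ptn // a.part 0 = 0} | (0 : ℤ) = (0 : ℕ)} = {o} := by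
        ext a
        simp [Subsingleton.elim a o]
      rw [this, Set.ncard_singleton]
      simp
    · have : {a : {a : Ptn // a.part 0 = 0} | (0 : ℤ) = (n : ℕ)} = ∅ := by
        ext a
        simp
        omega
      rw [this, Set.ncard_empty, if_neg hn.ne']
      simp
  | succ k ih =>
    rw [Finset.prod_range_succ]
    refine ih.mul_geom (by omega) (addColumns k) fun a => ?_
    rw [size_addColumns]
    push_cast
    ring

theorem isGenFunUpTo {N : ℕ} {h : ℕ} (hh : 1 ≤ h) {K : ℕ} (hK : N ≤ K) :
    IsGenFunUpTo N (fun a : Ptn => (h * a.size : ℤ))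
      (∏ i ∈ Finset.range K, (1 - z ^ (h * i + h))⁻¹) := by
  refine (isGenFunUpTo_of_part_eq_zero N hh K).of_injective Subtype.val
    Subtype.val_injective (fun _ => rfl) (fun _ => by positivity) fun b hb => ⟨⟨b, ?_⟩, rfl⟩
  by_contra hne
  have h1 := b.lt_size_of_part_ne_zero hne
  have h2 : b.size ≤ h * b.size := Nat.le_mul_of_pos_left _ hh
  have h3 : h * b.size < N := by exact_mod_cast hb
  omega

end Ptn

/-- One step of a walk on partitions: up along a horizontal strip if `s` is true, and down
otherwise. -/
def Step (s : Bool) (a b : Ptn) : Prop := if s then HStrip a b else HStrip b a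

/-- Walks from `a` to `b` whose steps have the directions prescribed by a list of
labelled directions. -/
def Walk : List (Bool × ℤ) → Ptn → Ptn → Type
  | [], a, b => {_u : Unit // a = b}
  | s :: l, a, b => Σ c : {c : Ptn // Step s.1 a c}, Walk l c.1 b

namespace Walk

/-- The weight of a walk: each step contributes its label times the change in size. -/
def weight : (l : List (Bool × ℤ)) → (a b : Ptn) → Walk l a b → ℤ
  | [], _, _, _ => 0
  | s :: l, a, b, p => s.2 * ((p.1.1.size : ℤ) - a.size) + weight l p.1.1 b p.2

theorem mk_congr {s t : Bool × ℤ} {l : List (Bool × ℤ)} {a b c c' d : Ptn} (hcc : c = c')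
    (hc : Step s.1 a c) (hd : Step t.1 c d) (hc' : Step s.1 a c') (hd' : Step t.1 c' d)
    (p : Walk l d b) :
    (⟨⟨c, hc⟩, ⟨d, hd⟩, p⟩ : Walk (s :: t :: l) a b) = ⟨⟨c', hc'⟩, ⟨d, hd'⟩, p⟩ := by
  subst hcc
  rfl

theorem exists_equiv_swap_head (x y : ℤ) (l : List (Bool × ℤ)) (a b : Ptn) :
    ∃ e : Walk ((true, x) :: (false, y) :: l) a b ≃ ℕ × Walk ((false, y) :: (true, x) :: l) a b,
      ∀ p, weight _ _ _ p = (x - y) * (e p).1 + weight _ _ _ (e p).2 := by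
  refine ⟨{
    toFun := fun p =>
      have t := Ptn.toggle a p.2.1.1 ⟨p.1.1, p.1.2, p.2.1.2⟩
      (t.1, ⟨⟨t.2.1, t.2.2.1⟩, ⟨p.2.1.1, t.2.2.2⟩, p.2.2⟩)
    invFun := fun q =>
      have t := (Ptn.toggle a q.2.2.1.1).symm (q.1, ⟨q.2.1.1, q.2.1.2, q.2.2.1.2⟩)
      ⟨⟨t.1, t.2.1⟩, ⟨q.2.2.1.1, t.2.2⟩, q.2.2.2⟩
    left_inv := ?_
    right_inv := ?_ }, ?_⟩
  · rintro ⟨⟨c, hc⟩, ⟨d, hd⟩, p⟩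
    have h := congrArg Subtype.val ((Ptn.toggle a d).symm_apply_apply ⟨c, hc, hd⟩)
    exact mk_congr (s := (true, x)) (t := (false, y)) h _ _ _ _ p
  · rintro ⟨m, ⟨c, hc⟩, ⟨d, hd⟩, p⟩
    have h := (Ptn.toggle a d).apply_symm_apply (m, ⟨c, hc, hd⟩)
    have h₁ := congrArg Prod.fst h
    have h₂ := congrArg (fun q => q.2.1) h
    refine Prod.ext ?_ ?_
    · exact h₁
    · exact mk_congr (s := (false, y)) (t := (true, x)) h₂ _ _ _ _ p
  · rintro ⟨⟨c, hc⟩, ⟨d, hd⟩, p⟩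
    have h := Ptn.size_toggle a d ⟨c, hc, hd⟩
    simp only [weight]
    zify at h
    linear_combination (x - y) * h

theorem exists_equiv_swap (l₁ : List (Bool × ℤ)) (x y : ℤ) (l₂ : List (Bool × ℤ)) (a b : Ptn) :
    ∃ e : Walk (l₁ ++ (true, x) :: (false, y) :: l₂) a b ≃
        ℕ × Walk (l₁ ++ (false, y) :: (true, x) :: l₂) a b,
      ∀ p, weight _ _ _ p = (x - y) * (e p).1 + weight _ _ _ (e p).2 := by
  induction l₁ generalizing a with
  | nil => exact exists_equiv_swap_head x y l₂ a b
  | cons s l₁ ih =>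
    choose e he using ih
    refine ⟨{
      toFun := fun p => ((e p.1.1 p.2).1, ⟨p.1, (e p.1.1 p.2).2⟩)
      invFun := fun q => ⟨q.2.1, (e q.2.1.1).symm (q.1, q.2.2)⟩
      left_inv := ?_
      right_inv := ?_ }, ?_⟩
    · rintro ⟨c, p⟩
      simp
      rfl
    · rintro ⟨m, c, p⟩
      simp
    · rintro ⟨c, p⟩
      have h := he c.1 p
      change s.2 * ((c.1.size : ℤ) - a.size) + weight (l₁ ++ (true, x) :: (false, y) :: l₂) _ _ p =
        (x - y) * ((e c.1 p).1 : ℤ) +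
        (s.2 * ((c.1.size : ℤ) - a.size) + weight _ _ _ (e c.1 p).2)
      rw [h]
      ring

theorem exists_equiv_append (l₁ l₂ : List (Bool × ℤ)) (a b : Ptn) :
    ∃ e : Walk (l₁ ++ l₂) a b ≃ Σ c : Ptn, Walk l₁ a c × Walk l₂ c b,
      ∀ p, weight _ _ _ p = weight _ _ _ (e p).2.1 + weight _ _ _ (e p).2.2 := by
  induction l₁ generalizing a with
  | nil =>
    refine ⟨{
      toFun := fun p => ⟨a, ⟨(), rfl⟩, p⟩
      invFun := fun q => q.2.1.2 ▸ q.2.2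
      left_inv := fun p => rfl
      right_inv := ?_ }, fun p => ?_⟩
    · rintro ⟨c, ⟨_, rfl⟩, p⟩
      rfl
    · simp [weight]
  | cons s l₁ ih =>
    choose e he using ih
    refine ⟨{
      toFun := fun p => ⟨(e p.1.1 p.2).1, ⟨p.1, (e p.1.1 p.2).2.1⟩, (e p.1.1 p.2).2.2⟩
      invFun := fun q => ⟨q.2.1.1, (e q.2.1.1.1).symm ⟨q.1, q.2.1.2, q.2.2⟩⟩
      left_inv := ?_
      right_inv := ?_ }, ?_⟩
    · rintro ⟨c, p⟩
      simp
      rfl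
    · rintro ⟨d, ⟨c, p⟩, q⟩
      simp only
      rw [(e c.1).apply_symm_apply]
    · rintro ⟨c, p⟩
      have h := he c.1 p
      change s.2 * ((c.1.size : ℤ) - a.size) + weight (l₁ ++ l₂) _ _ p =
        (s.2 * ((c.1.size : ℤ) - a.size) + weight _ _ _ (e c.1 p).2.1) +
          weight _ _ _ (e c.1 p).2.2
      rw [h]
      ring

theorem exists_equiv_shift (r : ℤ) (l : List (Bool × ℤ)) (a b : Ptn) :
    ∃ e : Walk l a b ≃ Walk (l.map fun s => (s.1, s.2 + r)) a b,
      ∀ p, weight _ _ _ (e p) = weight _ _ _ p + r * ((b.size : ℤ) - a.size) := by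
  induction l generalizing a with
  | nil =>
    refine ⟨Equiv.refl _, fun p => ?_⟩
    have hab : a = b := p.2
    change (0 : ℤ) = 0 + r * ((b.size : ℤ) - a.size)
    simp [hab]
  | cons s l ih =>
    choose e he using ih
    refine ⟨Equiv.sigmaCongrRight fun c => e c.1, ?_⟩
    rintro ⟨c, p⟩
    have h := he c.1 p
    change (s.2 + r) * ((c.1.size : ℤ) - a.size) + weight _ _ _ (e c.1 p) =
      s.2 * ((c.1.size : ℤ) - a.size) + weight _ _ _ p + r * ((b.size : ℤ) - a.size)
    rw [h]
    ring

end Walk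

/-- Closed walks with the given steps. -/
def ClosedWalk (l : List (Bool × ℤ)) : Type := Σ a : Ptn, Walk l a a

namespace ClosedWalk

/-- The weight of a closed walk; the size of the base point is counted `h` times. -/
def weight (h : ℤ) {l : List (Bool × ℤ)} (p : ClosedWalk l) : ℤ :=
  h * p.1.size + Walk.weight l p.1 p.1 p.2

variable {N : ℕ} {h : ℤ} {f : PowerSeries ℚ}

theorem isGenFunUpTo_swap {l₁ l₂ : List (Bool × ℤ)} {x y : ℤ} (hxy : y < x)
    (hf : IsGenFunUpTo N (weight h (l := l₁ ++ (false, y) :: (true, x) :: l₂)) f) :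
    IsGenFunUpTo N (weight h (l := l₁ ++ (true, x) :: (false, y) :: l₂))
      (f * (1 - z ^ (x - y).toNat)⁻¹) := by
  choose e he using fun a => Walk.exists_equiv_swap l₁ x y l₂ a a
  refine hf.mul_geom (by omega) {
    toFun := fun p => ((e p.1 p.2).1, ⟨p.1, (e p.1 p.2).2⟩)
    invFun := fun q => ⟨q.2.1, (e q.2.1).symm (q.1, q.2.2)⟩
    left_inv := ?_
    right_inv := ?_ } ?_
  · rintro ⟨c, p⟩
    simp
    rfl
  · rintro ⟨m, c, p⟩
    simp
  · rintro ⟨c, p⟩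
    change h * (c.size : ℤ) + Walk.weight _ _ _ p = ((x - y).toNat : ℤ) * ((e c p).1 : ℤ) +
      (h * (c.size : ℤ) + Walk.weight _ _ _ (e c p).2)
    rw [he c p, Int.toNat_of_nonneg (by omega)]
    ring

theorem isGenFunUpTo_rotate (l₁ l₂ : List (Bool × ℤ))
    (hf : IsGenFunUpTo N (weight h (l := (l₂.map fun s => (s.1, s.2 + h)) ++ l₁)) f) :
    IsGenFunUpTo N (weight h (l := l₁ ++ l₂)) f := by
  choose e he using fun a => Walk.exists_equiv_append l₁ l₂ a a
  choose e' he' using fun a =>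
    Walk.exists_equiv_append (l₂.map fun s => (s.1, s.2 + h)) l₁ a a
  choose t ht using Walk.exists_equiv_shift h l₂
  refine hf.congr {
    toFun := fun p =>
      have q := e p.1 p.2
      ⟨q.1, (e' q.1).symm ⟨p.1, t _ _ q.2.2, q.2.1⟩⟩
    invFun := fun p =>
      have q := e' p.1 p.2
      ⟨q.1, (e q.1).symm ⟨p.1, q.2.2, (t _ _).symm q.2.1⟩⟩
    left_inv := ?_
    right_inv := ?_ } ?_
  · rintro ⟨c, p⟩
    dsimp only
    rw [(e' _).apply_symm_apply]
    simp
    rfl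
  · rintro ⟨c, p⟩
    dsimp only
    rw [(e _).apply_symm_apply]
    simp
    rfl
  · rintro ⟨c, p⟩
    change h * (c.size : ℤ) + Walk.weight (l₁ ++ l₂) c c p =
      h * ((e c p).1.size : ℤ) + Walk.weight ((l₂.map fun s => (s.1, s.2 + h)) ++ l₁) _ _
        ((e' (e c p).1).symm ⟨c, t _ _ (e c p).2.2, (e c p).2.1⟩)
    rw [he c p]
    generalize e c p = q
    obtain ⟨d, p₁, p₂⟩ := q
    have h₂ := he' d ((e' d).symm ⟨c, t _ _ p₂, p₁⟩)
    rw [(e' _).apply_symm_apply] at h₂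
    rw [h₂, ht]
    ring

end ClosedWalk

/-- The product of `F s t` over all pairs of entries `s` preceding `t` in a list. -/
def pairProd {α M : Type} [CommMonoid M] (F : α → α → M) : List α → M
  | [] => 1
  | s :: l => (l.map (F s)).prod * pairProd F l

theorem pairProd_map_range' {α M : Type} [CommMonoid M] (F : α → α → M) (s : ℕ → α) (a n : ℕ) :
    pairProd F ((List.range' a n).map s) =
      ∏ i ∈ Finset.Ico a (a + n), ∏ j ∈ Finset.Ico a (a + n),
        if i < j then F (s i) (s j) else 1 := by
  induction n generalizing a with
  | zero => simp [pairProd]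
  | succ n ih =>
    have hrow : ((List.range' (a + 1) n).map fun j => F (s a) (s j)).prod =
        ∏ j ∈ Finset.Ico (a + 1) (a + 1 + n), F (s a) (s j) := by
      rw [Finset.prod_eq_multiset_prod]
      have : (Finset.Ico (a + 1) (a + 1 + n)).val = (List.range' (a + 1) n : Multiset ℕ) := by
        change (List.range' (a + 1) (a + 1 + n - (a + 1)) : Multiset ℕ) = _
        rw [Nat.add_sub_cancel_left]
      rw [this, Multiset.map_coe, Multiset.prod_coe]
    rw [List.range'_succ, List.map_cons, pairProd, ih, List.map_map,
      Finset.prod_eq_prod_Ico_succ_bot (by omega : a < a + (n + 1)),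
      show a + (n + 1) = a + 1 + n by omega]
    congr 1
    · change ((List.range' (a + 1) n).map fun j => F (s a) (s j)).prod = _
      rw [hrow, Finset.prod_eq_prod_Ico_succ_bot (by omega : a < a + 1 + n), if_neg (lt_irrefl a),
        one_mul]
      refine Finset.prod_congr rfl fun j hj => ?_
      rw [if_pos (by have := Finset.mem_Ico.mp hj; omega)]
    · refine Finset.prod_congr rfl fun i hi => ?_
      rw [Finset.prod_eq_prod_Ico_succ_bot (by omega : a < a + 1 + n),
        if_neg (by have := Finset.mem_Ico.mp hi; omega), one_mul]

/-- The factor contributed by an up step `s` preceding a down step `t`. -/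
noncomputable def upDownFactor (s t : Bool × ℤ) : PowerSeries ℚ :=
  if s.1 = true ∧ t.1 = false then (1 - z ^ (s.2 - t.2).toNat)⁻¹ else 1

/-- The factor contributed by a down step `s` preceding an up step `t`. -/
noncomputable def downUpFactor (s t : Bool × ℤ) : PowerSeries ℚ :=
  if s.1 = false ∧ t.1 = true then (1 - z ^ (t.2 - s.2).toNat)⁻¹ else 1

/-- Add `r` to the labels of the up steps. -/
def liftUps (r : ℤ) (l : List (Bool × ℤ)) : List (Bool × ℤ) :=
  l.map fun s => (s.1, if s.1 then s.2 + r else s.2)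

/-- The closed walks with steps `l` have generating function `f` up to degree `N`. -/
def HasWalkGenFun (N : ℕ) (h : ℤ) (l : List (Bool × ℤ)) (f : PowerSeries ℚ) : Prop :=
  IsGenFunUpTo N (ClosedWalk.weight h (l := l)) f

namespace HasWalkGenFun

variable {N : ℕ} {h : ℤ} {f : PowerSeries ℚ}

theorem cons_downs (x : ℤ) (l l₁ l₂ : List (Bool × ℤ))
    (hl : ∀ t ∈ l, t.1 = false → t.2 < x)
    (hf : HasWalkGenFun N h (l₁ ++ (l.filter (!·.1) ++ (true, x) :: l₂)) f) :
    HasWalkGenFun N h (l₁ ++ (true, x) :: (l.filter (!·.1) ++ l₂))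
      (f * (l.map (upDownFactor (true, x))).prod) := by
  induction l generalizing l₁ with
  | nil => simpa using hf
  | cons t l ih =>
    obtain ⟨b, y⟩ := t
    rw [List.forall_mem_cons] at hl
    cases b with
    | true => simpa [upDownFactor] using ih l₁ hl.2 (by simpa using hf)
    | false =>
      have h₁ := ih (l₁ ++ [(false, y)]) hl.2 (by simpa using hf)
      simp only [List.append_assoc, List.singleton_append] at h₁
      have h₂ : HasWalkGenFun _ _ _ _ := ClosedWalk.isGenFunUpTo_swap (hl.1 rfl) h₁
      simpa [upDownFactor, mul_assoc, mul_comm, mul_left_comm] using h₂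

theorem ups_cons (y : ℤ) (l l₁ l₂ : List (Bool × ℤ))
    (hl : ∀ t ∈ l, t.1 = true → y < t.2)
    (hf : HasWalkGenFun N h (l₁ ++ (false, y) :: (l.filter (·.1) ++ l₂)) f) :
    HasWalkGenFun N h (l₁ ++ (l.filter (·.1) ++ (false, y) :: l₂))
      (f * (l.map (downUpFactor (false, y))).prod) := by
  induction l generalizing l₁ f with
  | nil => simpa using hf
  | cons t l ih =>
    obtain ⟨b, x⟩ := t
    rw [List.forall_mem_cons] at hl
    cases b with
    | false => simpa [downUpFactor] using ih l₁ hl.2 (by simpa using hf)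
    | true =>
      have h₁ : HasWalkGenFun N h
          (l₁ ++ (true, x) :: (false, y) :: (l.filter (·.1) ++ l₂)) _ :=
        ClosedWalk.isGenFunUpTo_swap (hl.1 rfl) (show HasWalkGenFun N h _ f by simpa using hf)
      have h₂ := ih (l₁ ++ [(true, x)]) hl.2 (by simpa using h₁)
      simpa [downUpFactor, mul_assoc] using h₂

theorem of_downs_ups (l l₁ : List (Bool × ℤ))
    (hl : l.Pairwise fun s t => s.1 = true → t.1 = false → t.2 < s.2)
    (hf : HasWalkGenFun N h (l₁ ++ (l.filter (!·.1) ++ l.filter (·.1))) f) :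
    HasWalkGenFun N h (l₁ ++ l) (f * pairProd upDownFactor l) := by
  induction l generalizing l₁ f with
  | nil => simpa [pairProd] using hf
  | cons s l ih =>
    obtain ⟨b, x⟩ := s
    rw [List.pairwise_cons] at hl
    cases b with
    | false =>
      have h₁ := ih (l₁ ++ [(false, x)]) hl.2 (by simpa using hf)
      have h₂ : upDownFactor (false, x) = fun _ => 1 := by
        funext t
        simp [upDownFactor]
      simpa [pairProd, h₂] using h₁
    | true =>
      have h₁ := cons_downs x l l₁ (l.filter (·.1))
        (fun t ht => hl.1 t ht rfl) (by simpa using hf)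
      have h₂ := ih (l₁ ++ [(true, x)]) hl.2 (by simpa using h₁)
      simpa [pairProd, mul_assoc] using h₂

theorem ups_downs (l l₁ : List (Bool × ℤ))
    (hl : l.Pairwise fun s t => s.1 = false → t.1 = true → s.2 < t.2)
    (hf : HasWalkGenFun N h (l₁ ++ l) f) :
    HasWalkGenFun N h (l₁ ++ (l.filter (·.1) ++ l.filter (!·.1)))
      (f * pairProd downUpFactor l) := by
  induction l generalizing l₁ f with
  | nil => simpa [pairProd] using hf
  | cons s l ih =>
    obtain ⟨b, x⟩ := s
    rw [List.pairwise_cons] at hl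
    have h₁ := ih (l₁ ++ [(b, x)]) hl.2 (by simpa using hf)
    cases b with
    | true =>
      have h₂ : downUpFactor (true, x) = fun _ => 1 := by
        funext t
        simp [downUpFactor]
      simpa [pairProd, h₂] using h₁
    | false =>
      have h₂ := ups_cons x l l₁ (l.filter (!·.1))
        (fun t ht => hl.1 t ht rfl) (by simpa using h₁)
      simpa [pairProd, mul_assoc, mul_comm, mul_left_comm] using h₂

/-- Moving every up step once around the cycle. -/
theorem of_liftUps (l : List (Bool × ℤ))
    (hl : l.Pairwise fun s t => s.1 = true → t.1 = false → t.2 < s.2)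
    (hl' : (liftUps h l).Pairwise fun s t => s.1 = false → t.1 = true → s.2 < t.2)
    (hf : HasWalkGenFun N h (liftUps h l) f) :
    HasWalkGenFun N h l
      (f * (pairProd upDownFactor l * pairProd downUpFactor (liftUps h l))) := by
  have hups : (liftUps h l).filter (·.1) = (l.filter (·.1)).map fun s => (s.1, s.2 + h) := by
    rw [liftUps, List.filter_map]
    refine List.map_congr_left fun s hs => ?_
    have hs' : s.1 = true := by simpa using List.of_mem_filter hs
    rw [if_pos hs']
  have hdowns : (liftUps h l).filter (!·.1) = l.filter (!·.1) := by
    rw [liftUps, List.filter_map]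
    conv_rhs => rw [← List.map_id (l.filter (!·.1))]
    refine List.map_congr_left fun s hs => ?_
    have hs' : s.1 = false := by simpa using List.of_mem_filter hs
    rw [if_neg (by simp [hs']), id]
  have h₁ := ups_downs (liftUps h l) [] hl' hf
  rw [hups, hdowns, List.nil_append] at h₁
  have h₂ := of_downs_ups l [] hl
    (ClosedWalk.isGenFunUpTo_rotate (l.filter (!·.1)) (l.filter (·.1)) h₁)
  rw [List.nil_append] at h₂
  rwa [mul_comm (pairProd upDownFactor l), ← mul_assoc]

theorem _root_.liftUps_liftUps (r r' : ℤ) (l : List (Bool × ℤ)) :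
    liftUps r (liftUps r' l) = liftUps (r' + r) l := by
  simp only [liftUps, List.map_map]
  refine List.map_congr_left fun s _ => ?_
  rcases s with ⟨_ | _, x⟩ <;> simp [add_assoc]

theorem _root_.liftUps_zero (l : List (Bool × ℤ)) : liftUps 0 l = l := by
  simp [liftUps]

theorem of_liftUps_iterate (l : List (Bool × ℤ)) (hh : 0 ≤ h)
    (hl : l.Pairwise fun s t => t.2 < s.2 ∧ s.2 < t.2 + h) (K : ℕ)
    (hf : HasWalkGenFun N h (liftUps (h * K) l) f) :
    HasWalkGenFun N h l
      (f * ∏ k ∈ Finset.range K, (pairProd upDownFactor (liftUps (h * k) l) *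
        pairProd downUpFactor (liftUps (h * (k + 1)) l))) := by
  induction K generalizing f with
  | zero => simpa [liftUps_zero] using hf
  | succ K ih =>
    have hlift : liftUps h (liftUps (h * K) l) = liftUps (h * (K + 1)) l := by
      rw [liftUps_liftUps, mul_add, mul_one]
    have hK : 0 ≤ h * K := by positivity
    have h₁ := of_liftUps (N := N) (h := h) (f := f) (liftUps (h * K) l) ?_ ?_ ?_
    · rw [hlift] at h₁
      have h₂ := ih h₁
      rw [Finset.prod_range_succ]
      rwa [mul_assoc, mul_comm (_ * _)] at h₂
    · rw [liftUps, List.pairwise_map]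
      refine hl.imp fun {s t} hst => ?_
      rcases s with ⟨_ | _, x⟩ <;> rcases t with ⟨_ | _, y⟩ <;> simp at hst ⊢
      omega
    · rw [hlift, liftUps, List.pairwise_map, mul_add, mul_one]
      refine hl.imp fun {s t} hst => ?_
      rcases s with ⟨_ | _, x⟩ <;> rcases t with ⟨_ | _, y⟩ <;> simp at hst ⊢
      omega
    · rw [hlift]
      exact_mod_cast hf

end HasWalkGenFun

theorem HStrip.refl (a : Ptn) : HStrip a a := fun i => ⟨le_rfl, a.part_anti (Nat.le_succ i)⟩

theorem Step.refl (s : Bool) (a : Ptn) : Step s a a := by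
  cases s <;> exact HStrip.refl a

theorem HStrip.size_le {a b : Ptn} (hab : HStrip a b) : a.size ≤ b.size :=
  Ptn.size_le_of_part_le fun i => (hab i).1

theorem HStrip.eq_of_size_eq {a b : Ptn} (hab : HStrip a b) (hs : a.size = b.size) : a = b :=
  Ptn.eq_of_size_eq (fun i => (hab i).1) hs

namespace Walk

/-- The constant walk. -/
def const : (l : List (Bool × ℤ)) → (a : Ptn) → Walk l a a
  | [], _ => ⟨(), rfl⟩
  | s :: l, a => ⟨⟨a, Step.refl s.1 a⟩, const l a⟩

theorem weight_const (l : List (Bool × ℤ)) (a : Ptn) : weight l a a (const l a) = 0 := by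
  induction l with
  | nil => rfl
  | cons s l ih =>
    change s.2 * ((a.size : ℤ) - a.size) + weight l a a (const l a) = 0
    rw [ih]
    ring

theorem le_weight {N c : ℤ} (hN : 0 ≤ N) (l : List (Bool × ℤ))
    (hl : ∀ s ∈ l, if s.1 then c + N ≤ s.2 else s.2 ≤ c) (a b : Ptn) (p : Walk l a b) :
    c * ((b.size : ℤ) - a.size) ≤ weight l a b p ∧
      (weight l a b p < c * ((b.size : ℤ) - a.size) + N →
        b.size ≤ a.size ∧ (b.size = a.size → a = b ∧ HEq p (const l a))) := by
  induction l generalizing a with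
  | nil =>
    obtain ⟨⟨⟩, rfl⟩ := p
    exact ⟨by simp [weight], fun _ => ⟨le_rfl, fun _ => ⟨rfl, HEq.rfl⟩⟩⟩
  | cons s l ih =>
    obtain ⟨⟨d, hd⟩, p⟩ := p
    rw [List.forall_mem_cons] at hl
    obtain ⟨ih₁, ih₂⟩ := ih hl.2 d p
    obtain ⟨s, x⟩ := s
    have hw : weight ((s, x) :: l) a b ⟨⟨d, hd⟩, p⟩ =
      x * ((d.size : ℤ) - a.size) + weight l d b p := rfl
    rw [hw]
    have key : a = d → b.size = a.size →
        (b.size = d.size → d = b ∧ HEq p (const l d)) →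
        a = b ∧ HEq (⟨⟨d, hd⟩, p⟩ : Walk ((s, x) :: l) a b) (const ((s, x) :: l) a) := by
      rintro rfl hs h₁
      obtain ⟨rfl, h₃⟩ := h₁ hs
      refine ⟨rfl, ?_⟩
      cases h₃
      rfl
    cases s with
    | true =>
      have hx : c + N ≤ x := hl.1
      have hd' : HStrip a d := hd
      have hle := hd'.size_le
      have hle' : (0 : ℤ) ≤ d.size - a.size := by omega
      have h₁ : (c + N) * ((d.size : ℤ) - a.size) ≤ x * (d.size - a.size) :=
        mul_le_mul_of_nonneg_right hx hle'
      have h₂ : 0 ≤ N * ((d.size : ℤ) - a.size) := mul_nonneg hN hle'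
      refine ⟨by linarith, fun hlt => ?_⟩
      have hda : a.size = d.size := by
        by_contra hne
        have : N * 1 ≤ N * ((d.size : ℤ) - a.size) :=
          mul_le_mul_of_nonneg_left (by omega) hN
        linarith
      obtain ⟨h₃, h₄⟩ := ih₂ (by linarith)
      exact ⟨by omega, fun hba => key (hd'.eq_of_size_eq hda) hba h₄⟩
    | false =>
      have hx : x ≤ c := hl.1
      have hd' : HStrip d a := hd
      have hle := hd'.size_le
      have h₁ : 0 ≤ (c - x) * ((a.size : ℤ) - d.size) :=
        mul_nonneg (by omega) (by omega)
      refine ⟨by linarith, fun hlt => ?_⟩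
      obtain ⟨h₃, h₄⟩ := ih₂ (by linarith)
      exact ⟨by omega, fun hba => key (hd'.eq_of_size_eq (by omega)).symm hba h₄⟩

end Walk

theorem HasWalkGenFun.of_separated {N : ℕ} {h : ℕ} {c : ℤ} {f : PowerSeries ℚ}
    (l : List (Bool × ℤ)) (hl : ∀ s ∈ l, if s.1 then c + N ≤ s.2 else s.2 ≤ c)
    (hf : IsGenFunUpTo N (fun a : Ptn => (h * a.size : ℤ)) f) :
    HasWalkGenFun N h l f := by
  have hpos : ∀ p : ClosedWalk l, 0 ≤ (h : ℤ) * p.1.size := fun p => by positivity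
  refine hf.of_injective (fun a => (⟨a, Walk.const l a⟩ : ClosedWalk l))
    (fun a b hab => congrArg Sigma.fst hab) (fun a => ?_) (fun p => ?_) fun p hp => ⟨p.1, ?_⟩
  · simp [ClosedWalk.weight, Walk.weight_const]
  · have h₁ := (Walk.le_weight (Int.natCast_nonneg N) l hl p.1 p.1 p.2).1
    rw [sub_self, mul_zero] at h₁
    exact add_nonneg (hpos p) h₁
  · have h₁ := (Walk.le_weight (Int.natCast_nonneg N) l hl p.1 p.1 p.2).2
    rw [sub_self, mul_zero, zero_add] at h₁
    have h₂ := h₁ (by have := hpos p; unfold ClosedWalk.weight at hp; linarith)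
    exact Sigma.ext rfl (h₂.2 rfl).2.symm

theorem isDSPP_succ {n : ℕ} {δ : ℕ → ℤ} {L : Fin (n + 2) → Ptn} :
    IsDSPP (n + 2) δ L ↔ Step (decide (δ 1 = 1)) (L 0) (L (Fin.succ 0)) ∧
      IsDSPP (n + 1) (fun i => δ (i + 1)) fun i => L i.succ := by
  constructor
  · intro hL
    have h₀ : if δ 1 = 1 then HStrip (L 0) (L (Fin.succ 0))
      else HStrip (L (Fin.succ 0)) (L 0) := hL 0 (by omega)
    exact ⟨by simpa [Step] using h₀, fun i hi => hL (i + 1) (by omega)⟩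
  · rintro ⟨h₀, h₁⟩ i hi
    cases i with
    | zero =>
      change if δ 1 = 1 then HStrip (L 0) (L (Fin.succ 0)) else HStrip (L (Fin.succ 0)) (L 0)
      simpa [Step] using h₀
    | succ i => exact h₁ i (by omega)

theorem exists_equiv_walk (n : ℕ) (δ c : ℕ → ℤ) (a b : Ptn) :
    ∃ e : {L : Fin (n + 1) → Ptn // IsDSPP (n + 1) δ L ∧ L 0 = a ∧ L (Fin.last n) = b} ≃
        Walk ((List.range' 1 n).map fun i => (decide (δ i = 1), c i)) a b,
      ∀ L, Walk.weight _ a b (e L) =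
        ∑ i : Fin n, c (i + 1) * (((L.1 i.succ).size : ℤ) - (L.1 i.castSucc).size) := by
  induction n generalizing δ c a with
  | zero =>
    refine ⟨⟨fun L => ⟨(), L.2.2.1.symm.trans L.2.2.2⟩, fun p => ⟨fun _ => a,
      fun i hi => absurd hi (by omega), rfl, p.2⟩, ?_, fun p => rfl⟩, fun L => rfl⟩
    rintro ⟨L, h₁, rfl, h₂⟩
    refine Subtype.ext (funext fun i => ?_)
    rw [Fin.fin_one_eq_zero i]
  | succ n ih =>
    choose e he using ih (fun i => δ (i + 1)) (fun i => c (i + 1))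
    have hlist : (List.range' 1 (n + 1)).map (fun i => (decide (δ i = 1), c i)) =
        (decide (δ 1 = 1), c 1) ::
          (List.range' 1 n).map fun i => (decide (δ (i + 1) = 1), c (i + 1)) := by
      rw [List.range'_succ, List.map_cons, ← List.map_add_range' (a := 1) (s := 1), List.map_map]
      simp [Function.comp_def, add_comm]
    rw [hlist]
    let e₀ : {L : Fin (n + 2) → Ptn // IsDSPP (n + 2) δ L ∧ L 0 = a ∧ L (Fin.last (n + 1)) = b} ≃
        Σ d : {d // Step (decide (δ 1 = 1)) a d}, {L : Fin (n + 1) → Ptn //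
          IsDSPP (n + 1) (fun i => δ (i + 1)) L ∧ L 0 = d.1 ∧ L (Fin.last n) = b} :=
      { toFun := fun L => ⟨⟨L.1 (Fin.succ 0), by simpa only [L.2.2.1] using (isDSPP_succ.mp L.2.1).1⟩,
          fun i => L.1 i.succ, (isDSPP_succ.mp L.2.1).2, rfl, L.2.2.2⟩
        invFun := fun p => ⟨Fin.cons a p.2.1,
          isDSPP_succ.mpr
            ⟨by simpa only [Fin.cons_zero, Fin.cons_succ, p.2.2.2.1] using p.1.2, p.2.2.1⟩, rfl, p.2.2.2.2⟩
        left_inv := by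
          rintro ⟨L, h₁, rfl, h₂⟩
          exact Subtype.ext (Fin.cons_self_tail L)
        right_inv := by
          rintro ⟨⟨d, h₀⟩, L, h₁, h₂, h₃⟩
          obtain rfl : L 0 = d := h₂
          rfl }
    refine ⟨e₀.trans (Equiv.sigmaCongrRight fun d => e d.1), fun L => ?_⟩
    rw [Fin.sum_univ_succ]
    have h₁ := he _ (e₀ L).2
    change c 1 * (((L.1 (Fin.succ 0)).size : ℤ) - a.size) + Walk.weight _ _ _ (e _ (e₀ L).2) = _
    have h₀ : (L.1 (Fin.castSucc 0)).size = a.size := congrArg Ptn.size L.2.2.1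
    rw [h₁, h₀]
    rfl

theorem sum_mul_sub_add {n : ℕ} (v : Fin (n + 1) → ℤ) :
    (n : ℤ) * v 0 + ∑ i : Fin n, ((n : ℤ) - ((i : ℕ) + 1 : ℕ)) * (v i.succ - v i.castSucc) =
      ∑ i : Fin n, v i.castSucc := by
  induction n with
  | zero => simp
  | succ n ih =>
    have h₁ := ih fun i => v i.succ
    rw [Fin.sum_univ_succ, Fin.sum_univ_succ (fun i : Fin (n + 1) => v i.castSucc)]
    simp only [Fin.succ_castSucc] at h₁
    rw [← h₁]
    simp only [Fin.val_zero, Fin.val_succ, Fin.castSucc_zero, Nat.cast_add, Nat.cast_one,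
      Nat.cast_zero, add_sub_add_right_eq_sub, Fin.succ_zero_eq_one]
    ring

/-- The cylindric partitions of a profile as closed walks, with labels making their weight the
size. -/
theorem HasWalkGenFun.isGenFunUpTo_cylindric {N h : ℕ} {δ : ℕ → ℤ} {f : PowerSeries ℚ}
    (hf : HasWalkGenFun N h
      ((List.range' 1 h).map fun i => (decide (δ i = 1), (h : ℤ) - (i : ℕ))) f) :
    IsGenFunUpTo N (fun ω : {L : Fin (h + 1) → Ptn //
      IsDSPP (h + 1) δ L ∧ L 0 = L (Fin.last h)} =>
        ((∑ i : Fin h, (ω.1 i.castSucc).size : ℕ) : ℤ)) f := by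
  choose e he using exists_equiv_walk h δ (fun i => (h : ℤ) - (i : ℕ))
  let e₀ : {L : Fin (h + 1) → Ptn // IsDSPP (h + 1) δ L ∧ L 0 = L (Fin.last h)} ≃
      Σ a, {L : Fin (h + 1) → Ptn // IsDSPP (h + 1) δ L ∧ L 0 = a ∧ L (Fin.last h) = a} :=
    { toFun := fun L => ⟨L.1 0, L.1, L.2.1, rfl, L.2.2.symm⟩
      invFun := fun p => ⟨p.2.1, p.2.2.1, p.2.2.2.1.trans p.2.2.2.2.symm⟩
      left_inv := fun L => rfl
      right_inv := by
        rintro ⟨_, L, h₁, rfl, h₂⟩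
        rfl }
  refine IsGenFunUpTo.congr hf (e₀.trans (Equiv.sigmaCongrRight fun a => e a a)) fun L => ?_
  have h₁ := he _ _ (e₀ L).2
  change _ = (h : ℤ) * (L.1 0).size + Walk.weight _ _ _ (e _ _ (e₀ L).2)
  rw [h₁, Nat.cast_sum, ← sum_mul_sub_add fun i => ((L.1 i).size : ℤ)]
  rfl

/-- The steps of a profile, the `i`-th one being labelled `h - i`. -/
def profileSteps (h : ℕ) (δ : ℕ → ℤ) : List (Bool × ℤ) :=
  (List.range' 1 h).map fun i => (decide (δ i = 1), (h : ℤ) - (i : ℕ))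

theorem liftUps_profileSteps (r : ℤ) (h : ℕ) (δ : ℕ → ℤ) :
    liftUps r (profileSteps h δ) = (List.range' 1 h).map fun i =>
      (decide (δ i = 1), if δ i = 1 then (h : ℤ) - (i : ℕ) + r else (h : ℤ) - (i : ℕ)) := by
  simp [liftUps, profileSteps, Function.comp_def]

theorem prod_W3 {h : ℕ} {δ : ℕ → ℤ} (hδ : IsProfile h δ) (k : ℕ) :
    ((W3 h δ).map fun t => (1 - z ^ (h * k + t))⁻¹).prod =
      (1 - z ^ (h * k + h))⁻¹ * (pairProd upDownFactor (liftUps (h * k) (profileSteps h δ)) *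
        pairProd downUpFactor (liftUps (h * (k + 1)) (profileSteps h δ))) := by
  have hIcc : Finset.Icc 1 h = Finset.Ico 1 (1 + h) := by
    ext i
    simp only [Finset.mem_Icc, Finset.mem_Ico]
    omega
  have hprod : ∀ (s : Finset (ℕ × ℕ)) (g : ℕ × ℕ → ℕ),
      (s.val.map ((fun t => (1 - z ^ (h * k + t))⁻¹) ∘ g)).prod =
        ∏ q ∈ s, (1 - z ^ (h * k + g q))⁻¹ := fun _ _ => rfl
  rw [W3, Multiset.map_cons, Multiset.prod_cons, Multiset.map_add, Multiset.prod_add,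
    Multiset.map_map, Multiset.map_map, liftUps_profileSteps, liftUps_profileSteps,
    pairProd_map_range', pairProd_map_range', hIcc, hprod, hprod]
  congr 2
  · rw [Finset.prod_filter, Finset.prod_product]
    refine Finset.prod_congr rfl fun i hi => Finset.prod_congr rfl fun j hj => ?_
    rw [Finset.mem_Ico] at hi hj
    by_cases hij : i < j
    · have hexp : ((h : ℤ) - i + h * k - (h - j)).toNat = h * k + (j - i) := by
        rw [← Nat.cast_mul]
        omega
      rcases hδ i hi.1 (by omega) with h₁ | h₁ <;> rcases hδ j hj.1 (by omega) with h₂ | h₂ <;>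
        simp [upDownFactor, hij, h₁, h₂, hexp]
    · simp [hij]
  · rw [Finset.prod_filter, Finset.prod_product]
    refine Finset.prod_congr rfl fun i hi => Finset.prod_congr rfl fun j hj => ?_
    rw [Finset.mem_Ico] at hi hj
    by_cases hij : i < j
    · have hexp : ((h : ℤ) - j + h * (k + 1) - (h - i)).toNat = h * k + (h + i - j) := by
        rw [mul_add, mul_one, ← Nat.cast_mul]
        omega
      rcases hδ i hi.1 (by omega) with h₁ | h₁ <;> rcases hδ j hj.1 (by omega) with h₂ | h₂ <;>
        simp [downUpFactor, hij, h₁, h₂, hexp]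
    · simp [hij]

theorem isGenFunUpTo_cylindric {h : ℕ} (hh : 1 ≤ h) {δ : ℕ → ℤ} (hδ : IsProfile h δ) {N K : ℕ}
    (hK : N < K) :
    IsGenFunUpTo N (fun ω : {L : Fin (h + 1) → Ptn //
      IsDSPP (h + 1) δ L ∧ L 0 = L (Fin.last h)} =>
        ((∑ i : Fin h, (ω.1 i.castSucc).size : ℕ) : ℤ))
      (∏ k ∈ Finset.range K, ((W3 h δ).map fun t => (1 - z ^ (h * k + t))⁻¹).prod) := by
  refine HasWalkGenFun.isGenFunUpTo_cylindric ?_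
  simp_rw [prod_W3 hδ, Finset.prod_mul_distrib (f := fun k => (1 - z ^ (h * k + h))⁻¹)]
  refine HasWalkGenFun.of_liftUps_iterate (profileSteps h δ) (Int.natCast_nonneg h) ?_ K
    (HasWalkGenFun.of_separated (c := h) _ ?_ (Ptn.isGenFunUpTo hh hK.le))
  · rw [profileSteps, List.pairwise_map]
    refine (List.pairwise_lt_range' (s := 1) (n := h)).imp_of_mem fun {i j} hi hj hij => ?_
    rw [List.mem_range'_1] at hi hj
    simp only
    omega
  · intro s hs
    rw [liftUps_profileSteps, List.mem_map] at hs
    obtain ⟨i, hi, rfl⟩ := hs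
    rw [List.mem_range'_1] at hi
    have hKN : N + h ≤ h * K := by nlinarith
    have hKN' : (N : ℤ) + h ≤ h * K := by exact_mod_cast hKN
    by_cases hi' : δ i = 1
    · simp only [hi', decide_true, if_true]
      omega
    · simp [hi']

instance : T2Space (PowerSeries ℚ) := inferInstanceAs (T2Space ((Unit →₀ ℕ) → ℚ))

theorem tendsto_powerSeries_iff {α : Type} {l : Filter α} {f : α → PowerSeries ℚ}
    {g : PowerSeries ℚ} : Filter.Tendsto f l (nhds g) ↔
      ∀ n, Filter.Tendsto (fun a => (f a).coeff n) l (nhds (g.coeff n)) := by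
  have h₁ : Filter.Tendsto f l (nhds g) ↔
      ∀ d : Unit →₀ ℕ, Filter.Tendsto (fun a => (f a : (Unit →₀ ℕ) → ℚ) d) l (nhds (g d)) :=
    tendsto_pi_nhds
  rw [h₁]
  refine ⟨fun hd n => hd (Finsupp.single () n), fun hn d => ?_⟩
  have hd : d = Finsupp.single () (d ()) := Finsupp.unique_ext (by simp)
  rw [hd]
  exact hn (d ())

theorem coeff_eq_of_mk_eq {m n : ℕ} (hn : n < m) {f g : PowerSeries ℚ}
    (hfg : Ideal.Quotient.mk (Ideal.span {(z ^ m : PowerSeries ℚ)}) f = Ideal.Quotient.mk _ g) :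
    f.coeff n = g.coeff n := by
  rw [Ideal.Quotient.eq, Ideal.mem_span_singleton, z, PowerSeries.X_pow_dvd_iff] at hfg
  have := hfg n hn
  rwa [map_sub, sub_eq_zero] at this

theorem mk_geom_eq_one {m d : ℕ} (hm : 1 ≤ m) (hd : m ≤ d) :
    Ideal.Quotient.mk (Ideal.span {(z ^ m : PowerSeries ℚ)}) (1 - z ^ d)⁻¹ = 1 := by
  have hinv : (1 - z ^ d) * (1 - z ^ d)⁻¹ = 1 := by
    refine PowerSeries.mul_inv_cancel _ ?_
    simp [z, show d ≠ 0 by omega]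
  have hz : Ideal.Quotient.mk (Ideal.span {(z ^ m : PowerSeries ℚ)}) (z ^ d) = 0 :=
    Ideal.Quotient.eq_zero_iff_mem.mpr (Ideal.mem_span_singleton.mpr (pow_dvd_pow z hd))
  have := congrArg (Ideal.Quotient.mk (Ideal.span {(z ^ m : PowerSeries ℚ)})) hinv
  rwa [map_mul, map_sub, hz, map_one, sub_zero, one_mul] at this

theorem hasSum_of_isGenFunUpTo {α : Type} {w : α → ℕ} {F : PowerSeries ℚ}
    (hF : ∀ n, ∃ f, IsGenFunUpTo (n + 1) (fun a => (w a : ℤ)) f ∧ f.coeff n = F.coeff n) :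
    HasSum (fun a => z ^ w a) F := by
  refine tendsto_powerSeries_iff.mpr fun n => ?_
  obtain ⟨f, hf, hfF⟩ := hF n
  obtain ⟨hfin, hcard⟩ := hf.2 n (Nat.lt_succ_self n)
  have hcoeff : ∀ a, (z ^ w a).coeff n = if w a = n then 1 else 0 := fun a => by
    rw [z, PowerSeries.coeff_X_pow]
    simp [eq_comm]
  have h₁ : HasSum (fun a => (z ^ w a).coeff n) (F.coeff n) := by
    rw [← hfF, hcard, Set.ncard_eq_toFinset_card _ hfin, Finset.card_eq_sum_ones, Nat.cast_sum]
    have h₂ : ∑ a ∈ hfin.toFinset, (z ^ w a).coeff n = ∑ a ∈ hfin.toFinset, ((1 : ℕ) : ℚ) :=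
      Finset.sum_congr rfl fun a ha => by
        have ha' : w a = n := by simpa using ha
        rw [hcoeff, if_pos ha', Nat.cast_one]
    rw [← h₂]
    refine hasSum_sum_of_ne_finset_zero fun a ha => ?_
    have ha' : w a ≠ n := by simpa using ha
    rw [hcoeff, if_neg ha']
  simpa [HasSum] using h₁

theorem hasProd_of_mk_eq_one {G : ℕ → PowerSeries ℚ} {F : PowerSeries ℚ}
    (hG : ∀ n k, n < k → Ideal.Quotient.mk (Ideal.span {(z ^ (n + 1) : PowerSeries ℚ)}) (G k) = 1)
    (hF : ∀ n, (∏ k ∈ Finset.range (n + 2), G k).coeff n = F.coeff n) :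
    HasProd G F := by
  refine tendsto_powerSeries_iff.mpr fun n => ?_
  refine tendsto_const_nhds.congr' ?_
  simp only [SummationFilter.unconditional_filter]
  filter_upwards [Filter.eventually_ge_atTop (Finset.range (n + 2))] with s hs
  rw [← hF n]
  refine (coeff_eq_of_mk_eq (Nat.lt_succ_self n) ?_).symm
  rw [← Finset.prod_sdiff hs, map_mul, map_prod, Finset.prod_eq_one, one_mul]
  intro k hk
  exact hG n k (by simp at hk; omega)

/-- **Borodin's theorem** (Theorem 6.1): the generating function for cylindric
partitions with profile `δ = (δ_1, …, δ_h)` (the size of a cylindric partition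
`(λ^0, …, λ^h)`, `λ^0 = λ^h`, being `Σ_{i=0}^{h-1} |λ^i|`) is
`Σ_{ω ∈ CP_δ} z^{|ω|} = ∏_{k≥0} ∏_{t ∈ W_3(δ)} (1 - z^{hk+t})⁻¹`. -/
theorem gf_cylindric_partitions (h : ℕ) (hh : 1 ≤ h) (δ : ℕ → ℤ)
    (hδ : IsProfile h δ) :
    ∑' ω : {L : Fin (h + 1) → Ptn // IsDSPP (h + 1) δ L ∧ L 0 = L (Fin.last h)},
      z ^ (∑ i : Fin h, (ω.1 i.castSucc).size)
    = ∏' k : ℕ, ((W3 h δ).map (fun t => (1 - z ^ (h * k + t))⁻¹)).prod := by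
  obtain ⟨F, hF⟩ : ∃ F : PowerSeries ℚ, ∀ n, (∏ k ∈ Finset.range (n + 2),
      ((W3 h δ).map fun t => (1 - z ^ (h * k + t))⁻¹).prod).coeff n = F.coeff n :=
    ⟨PowerSeries.mk fun n => (∏ k ∈ Finset.range (n + 2),
      ((W3 h δ).map fun t => (1 - z ^ (h * k + t))⁻¹).prod).coeff n,
      fun n => by rw [PowerSeries.coeff_mk]⟩
  have hsum := hasSum_of_isGenFunUpTo (F := F) fun n =>
    ⟨_, isGenFunUpTo_cylindric hh hδ (Nat.lt_succ_self (n + 1)), hF n⟩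
  rw [hsum.tsum_eq]
  refine (HasProd.tprod_eq (hasProd_of_mk_eq_one (fun n k hk => ?_) hF)).symm
  rw [map_multiset_prod, Multiset.map_map]
  refine Multiset.prod_eq_one fun g hg => ?_
  obtain ⟨t, -, rfl⟩ := Multiset.mem_map.mp hg
  exact mk_geom_eq_one (Nat.le_add_left 1 n) (by nlinarith)
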